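/- Let M be a complex manifold of dimension n and 𝒰 = {U_0, U_1} an open covering. The map E^{n,n}_A(𝒰) → E^{2n}(𝒰) given by (ξ_0, ξ_1, ξ_{01}^{(1)}, ξ_{01}^{(2)}) ↦ (ξ_0, ξ_1, ξ_{01}^{(1)} + ξ_{01}^{(2)}) induces an isomorphism H^{n,n}_A(𝒰) ≅ H^{2n}_D(𝒰) between the Čech-Aeppli cohomology of top type and the top-degree Čech-de Rham cohomology. -/

import Mathlib

/-!
Statement 12 (Proposition 4.4 of the paper).  Let `M` be a complex manifold of dimension
`n` and `𝒰 = {U₀, U₁}` an open covering.  The map `E^{n,n}_A(𝒰) → E^{2n}(𝒰)`,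
`(ξ₀, ξ₁, ξ₀₁⁽¹⁾, ξ₀₁⁽²⁾) ↦ (ξ₀, ξ₁, ξ₀₁⁽¹⁾ + ξ₀₁⁽²⁾)` induces an isomorphism
`H^{n,n}_A(𝒰) ≅ H^{2n}_D(𝒰)` of the top Čech–Aeppli cohomology with the top-degree
Čech–de Rham cohomology.

The sheaves of forms are modelled abstractly by `DoubleFormSheaf`; that `M` has complex
dimension `n` is encoded by the hypothesis that `E^{a,b} = 0` for `a > n` or `b > n`.
Under this hypothesis the de Rham spaces in total degrees `2n-1`, `2n`, `2n+1` decompose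
as `E^{2n-1} = E^{n,n-1} ⊕ E^{n-1,n}`, `E^{2n-2} = E^{n,n-2} ⊕ E^{n-1,n-1} ⊕ E^{n-2,n}`,
`E^{2n} = E^{n,n}`, `E^{2n+1} = E^{n+1,n} ⊕ E^{n,n+1}`, and the Čech–de Rham complex
`E^{2n-1}(𝒰) → E^{2n}(𝒰) → E^{2n+1}(𝒰)` is realized below on these components (`DR1`,
`DRd1`, `DRd2`); the sum `ξ₀₁⁽¹⁾ + ξ₀₁⁽²⁾ ∈ E^{2n-1}(U₀₁)` corresponds to the pair
`(ξ₀₁⁽¹⁾, ξ₀₁⁽²⁾)` under the identification `E^{2n-1} = E^{n,n-1} ⊕ E^{n-1,n}`, so the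
comparison map becomes the identity of the underlying cochain groups.
-/

open TopologicalSpace

universe u

section LinearHelpers

variable {A B C S : Type u} [AddCommGroup A] [Module ℂ A] [AddCommGroup B] [Module ℂ B]
  [AddCommGroup C] [Module ℂ C] [AddCommGroup S] [Module ℂ S]

/-- a linear map into a triple product -/
def lmTri (f : S →ₗ[ℂ] A) (g : S →ₗ[ℂ] B) (h : S →ₗ[ℂ] C) : S →ₗ[ℂ] A × B × C :=
  LinearMap.prod f (LinearMap.prod g h)

/-- first projection of a triple product -/
def pA : A × B × C →ₗ[ℂ] A := LinearMap.fst ℂ A (B × C)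

/-- second projection of a triple product -/
def pB : A × B × C →ₗ[ℂ] B := (LinearMap.fst ℂ B C).comp (LinearMap.snd ℂ A (B × C))

/-- third projection of a triple product -/
def pC : A × B × C →ₗ[ℂ] C := (LinearMap.snd ℂ B C).comp (LinearMap.snd ℂ A (B × C))

/-- first projection of a pair -/
def qA : A × B →ₗ[ℂ] A := LinearMap.fst ℂ A B

/-- second projection of a pair -/
def qB : A × B →ₗ[ℂ] B := LinearMap.snd ℂ A B

end LinearHelpers

/-- The cohomology of a pair of composable linear maps `f : A → B`, `g : B → C` with
`g ∘ f = 0` (in the situations where this is used):  `Ker g / Im f`. -/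
abbrev cohomOf {A B C : Type u} [AddCommGroup A] [Module ℂ A] [AddCommGroup B] [Module ℂ B]
    [AddCommGroup C] [Module ℂ C] (f : A →ₗ[ℂ] B) (g : B →ₗ[ℂ] C) : Type u :=
  ↥(LinearMap.ker g) ⧸ (Submodule.comap (LinearMap.ker g).subtype (LinearMap.range f))

/-- The cohomology class of a cocycle. -/
def cohomMk {A B C : Type u} [AddCommGroup A] [Module ℂ A] [AddCommGroup B] [Module ℂ B]
    [AddCommGroup C] [Module ℂ C] (f : A →ₗ[ℂ] B) (g : B →ₗ[ℂ] C) (b : B) (hb : g b = 0) :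
    cohomOf f g :=
  Submodule.Quotient.mk ⟨b, LinearMap.mem_ker.mpr hb⟩

/-- The sheaves `E^{p,q}` of `C^∞` differential forms of type `(p,q)` on (the underlying
topological space of) a complex manifold, encoded abstractly: a presheaf of `ℂ`-modules
`E p q U` with the differentials `∂` (`del`) and `∂̄` (`dbar`), satisfying `∂² = ∂̄² = 0`,
`∂∂̄ + ∂̄∂ = 0`, compatibility with restrictions, the sheaf gluing condition for pairs of
open sets, and the softness property coming from `C^∞` partitions of unity (`pou`). -/
structure DoubleFormSheaf (X : Type u) [TopologicalSpace X] : Type (u + 1) where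
  /-- the `ℂ`-module of `(p,q)`-forms on an open set `U` -/
  E : ℤ → ℤ → Opens X → ModuleCat.{u} ℂ
  /-- restriction of forms -/
  res : ∀ (p q : ℤ) ⦃U V : Opens X⦄, U ≤ V → ((E p q V) →ₗ[ℂ] (E p q U))
  res_refl : ∀ (p q : ℤ) (U : Opens X) (x : E p q U), res p q (le_refl U) x = x
  res_res : ∀ (p q : ℤ) ⦃U V W : Opens X⦄ (hUV : U ≤ V) (hVW : V ≤ W) (x : E p q W),
      res p q hUV (res p q hVW x) = res p q (hUV.trans hVW) x
  /-- the differential `∂` -/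
  del : ∀ (p q : ℤ) (U : Opens X), (E p q U) →ₗ[ℂ] (E (p + 1) q U)
  /-- the differential `∂̄` -/
  dbar : ∀ (p q : ℤ) (U : Opens X), (E p q U) →ₗ[ℂ] (E p (q + 1) U)
  del_del : ∀ (p q : ℤ) (U : Opens X) (x : E p q U), del (p + 1) q U (del p q U x) = 0
  dbar_dbar : ∀ (p q : ℤ) (U : Opens X) (x : E p q U), dbar p (q + 1) U (dbar p q U x) = 0
  del_dbar : ∀ (p q : ℤ) (U : Opens X) (x : E p q U),
      del p (q + 1) U (dbar p q U x) + dbar (p + 1) q U (del p q U x) = 0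
  res_del : ∀ (p q : ℤ) ⦃U V : Opens X⦄ (h : U ≤ V) (x : E p q V),
      del p q U (res p q h x) = res (p + 1) q h (del p q V x)
  res_dbar : ∀ (p q : ℤ) ⦃U V : Opens X⦄ (h : U ≤ V) (x : E p q V),
      dbar p q U (res p q h x) = res p (q + 1) h (dbar p q V x)
  /-- sheaf condition: forms agreeing on the overlap glue -/
  glue : ∀ (p q : ℤ) ⦃U V : Opens X⦄ (a : E p q U) (b : E p q V),
      res p q inf_le_left a = res p q inf_le_right b →
      ∃! c : E p q (U ⊔ V), res p q le_sup_left c = a ∧ res p q le_sup_right c = b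
  /-- softness coming from `C^∞` partitions of unity subordinate to a two-set open cover:
  "multiplication by `ρ₁` (resp. `ρ₀`) followed by extension by zero" operators. -/
  pou : ∀ ⦃U V : Opens X⦄, U ⊔ V = ⊤ →
      ∃ (z₀ : ∀ p q : ℤ, ((E p q (U ⊓ V)) →ₗ[ℂ] (E p q U)))
        (z₁ : ∀ p q : ℤ, ((E p q (U ⊓ V)) →ₗ[ℂ] (E p q V))),
        ∀ (p q : ℤ) (x : E p q (U ⊓ V)),
          res p q inf_le_left (z₀ p q x) + res p q inf_le_right (z₁ p q x) = x

namespace DoubleFormSheaf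

variable {X : Type u} [TopologicalSpace X] (F : DoubleFormSheaf X)

/-- identification of the modules of forms in equal bidegrees -/
def cast (U : Opens X) :
    ∀ {p q p' q' : ℤ}, p = p' → q = q' → ((F.E p q U) →ₗ[ℂ] (F.E p' q' U))
  | _, _, _, _, rfl, rfl => LinearMap.id

section Cech

variable (U₀ U₁ : Opens X)

/-- Čech–Bott–Chern cochains `E^{p,q}_{BC}(𝒰) = E^{p,q}(U₀) ⊕ E^{p,q}(U₁) ⊕ E^{p-1,q-1}(U₀₁)` -/
abbrev TBC (p q : ℤ) : Type u :=
  ↥(F.E p q U₀) × ↥(F.E p q U₁) × ↥(F.E (p - 1) (q - 1) (U₀ ⊓ U₁))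

/-- Čech–Aeppli cochains
`E^{p,q}_{A}(𝒰) = E^{p,q}(U₀) ⊕ E^{p,q}(U₁) ⊕ E^{(p-1,q-1)+1}(U₀₁)`,
`E^{(p-1,q-1)+1} = E^{p,q-1} ⊕ E^{p-1,q}` -/
abbrev TA (p q : ℤ) : Type u :=
  ↥(F.E p q U₀) × ↥(F.E p q U₁) ×
    (↥(F.E p (q - 1) (U₀ ⊓ U₁)) × ↥(F.E (p - 1) q (U₀ ⊓ U₁)))

/-- Čech cochains of the third type
`E^{(p,q)+1}(𝒰) = E^{(p,q)+1}(U₀) ⊕ E^{(p,q)+1}(U₁) ⊕ E^{p,q}(U₀₁)`,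
`E^{(p,q)+1} = E^{p+1,q} ⊕ E^{p,q+1}` -/
abbrev TT (p q : ℤ) : Type u :=
  (↥(F.E (p + 1) q U₀) × ↥(F.E p (q + 1) U₀)) ×
    (↥(F.E (p + 1) q U₁) × ↥(F.E p (q + 1) U₁)) × ↥(F.E p q (U₀ ⊓ U₁))

/-- Čech–Dolbeault cochains `E^{p,q}(𝒰) = E^{p,q}(U₀) ⊕ E^{p,q}(U₁) ⊕ E^{p,q-1}(U₀₁)` -/
abbrev TD (p q : ℤ) : Type u :=
  ↥(F.E p q U₀) × ↥(F.E p q U₁) × ↥(F.E p (q - 1) (U₀ ⊓ U₁))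

/-- relative Čech–Bott–Chern cochains `E^{p,q}_{BC}(𝒰, U₀) = E^{p,q}(U₁) ⊕ E^{p-1,q-1}(U₀₁)` -/
abbrev RBC (p q : ℤ) : Type u :=
  ↥(F.E p q U₁) × ↥(F.E (p - 1) (q - 1) (U₀ ⊓ U₁))

/-- relative Čech–Aeppli cochains `E^{p,q}_{A}(𝒰, U₀) = E^{p,q}(U₁) ⊕ E^{(p-1,q-1)+1}(U₀₁)` -/
abbrev RA (p q : ℤ) : Type u :=
  ↥(F.E p q U₁) × (↥(F.E p (q - 1) (U₀ ⊓ U₁)) × ↥(F.E (p - 1) q (U₀ ⊓ U₁)))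

/-- relative Čech cochains of the third type `E^{(p,q)+1}(𝒰, U₀) = E^{(p,q)+1}(U₁) ⊕ E^{p,q}(U₀₁)` -/
abbrev RT (p q : ℤ) : Type u :=
  (↥(F.E (p + 1) q U₁) × ↥(F.E p (q + 1) U₁)) × ↥(F.E p q (U₀ ⊓ U₁))

/-- relative Čech–Dolbeault cochains `E^{p,q}(𝒰, U₀) = E^{p,q}(U₁) ⊕ E^{p,q-1}(U₀₁)` -/
abbrev RD (p q : ℤ) : Type u :=
  ↥(F.E p q U₁) × ↥(F.E p (q - 1) (U₀ ⊓ U₁))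

/-- the Čech differential `E^{p,q}_{BC}(𝒰) → E^{(p,q)+1}(𝒰)`,
`σ ↦ ((∂σ₀, ∂̄σ₀), (∂σ₁, ∂̄σ₁), σ₁ - σ₀ - ∂̄∂σ₀₁)` (i.e. `σ ↦ (dσ₀, dσ₁, σ₁ - σ₀ - ∂̄∂σ₀₁)`) -/
def DtoTT (p q : ℤ) : TBC F U₀ U₁ p q →ₗ[ℂ] TT F U₀ U₁ p q :=
  lmTri
    (LinearMap.prod ((F.del p q U₀).comp pA) ((F.dbar p q U₀).comp pA))
    (LinearMap.prod ((F.del p q U₁).comp pB) ((F.dbar p q U₁).comp pB))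
    (((F.res p q inf_le_right).comp pB - (F.res p q inf_le_left).comp pA) -
      ((F.cast (U₀ ⊓ U₁) (show p - 1 + 1 = p by ring) (show q - 1 + 1 = q by ring)).comp
        ((F.dbar (p - 1 + 1) (q - 1) (U₀ ⊓ U₁)).comp
          ((F.del (p - 1) (q - 1) (U₀ ⊓ U₁)).comp pC))))

/-- the Čech differential `E^{(p,q)+1}(𝒰) → E^{p+1,q+1}_{A?}(𝒰)`; more precisely the
differential `E^{(p,q)+1}(𝒰) → E^{p+1,q+1}(𝒰)`-component of the mixed complex, landing in
the Aeppli-type cochains `E^{p+1,q+1}_{A}(𝒰)`: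
`((α₀,β₀), (α₁,β₁), γ) ↦ (∂̄α₀ + ∂β₀, ∂̄α₁ + ∂β₁, (α₁ - α₀ - ∂γ, β₁ - β₀ - ∂̄γ))` -/
def DtoTA (p q : ℤ) : TT F U₀ U₁ p q →ₗ[ℂ] TA F U₀ U₁ (p + 1) (q + 1) :=
  lmTri
    (((F.dbar (p + 1) q U₀).comp (qA.comp pA)) + ((F.del p (q + 1) U₀).comp (qB.comp pA)))
    (((F.dbar (p + 1) q U₁).comp (qA.comp pB)) + ((F.del p (q + 1) U₁).comp (qB.comp pB)))
    (LinearMap.prod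
      ((F.cast (U₀ ⊓ U₁) rfl (show q = q + 1 - 1 by ring)).comp
        (((F.res (p + 1) q inf_le_right).comp (qA.comp pB) -
            (F.res (p + 1) q inf_le_left).comp (qA.comp pA)) -
          ((F.del p q (U₀ ⊓ U₁)).comp pC)))
      ((F.cast (U₀ ⊓ U₁) (show p = p + 1 - 1 by ring) rfl).comp
        (((F.res p (q + 1) inf_le_right).comp (qB.comp pB) -
            (F.res p (q + 1) inf_le_left).comp (qB.comp pA)) -
          ((F.dbar p q (U₀ ⊓ U₁)).comp pC))))

/-- the Čech differential `E^{p,q}_{A}(𝒰) → E^{p+1,q+1}_{BC}(𝒰)`: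
`(ξ₀, ξ₁, (η₁, η₂)) ↦ (∂̄∂ξ₀, ∂̄∂ξ₁, ξ₁ - ξ₀ - ∂̄η₁ - ∂η₂)` -/
def DtoTBC (p q : ℤ) : TA F U₀ U₁ p q →ₗ[ℂ] TBC F U₀ U₁ (p + 1) (q + 1) :=
  lmTri
    ((F.dbar (p + 1) q U₀).comp ((F.del p q U₀).comp pA))
    ((F.dbar (p + 1) q U₁).comp ((F.del p q U₁).comp pB))
    ((F.cast (U₀ ⊓ U₁) (show p = p + 1 - 1 by ring) (show q = q + 1 - 1 by ring)).comp
      ((((F.res p q inf_le_right).comp pB - (F.res p q inf_le_left).comp pA) -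
          ((F.cast (U₀ ⊓ U₁) rfl (show q - 1 + 1 = q by ring)).comp
            ((F.dbar p (q - 1) (U₀ ⊓ U₁)).comp (qA.comp pC)))) -
        ((F.cast (U₀ ⊓ U₁) (show p - 1 + 1 = p by ring) rfl).comp
          ((F.del (p - 1) q (U₀ ⊓ U₁)).comp (qB.comp pC)))))

/-- the Čech–Dolbeault differential `∂̄ϑ σ = (∂̄σ₀, ∂̄σ₁, σ₁ - σ₀ - ∂̄σ₀₁)` -/
def DD (p q : ℤ) : TD F U₀ U₁ p q →ₗ[ℂ] TD F U₀ U₁ p (q + 1) :=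
  lmTri
    ((F.dbar p q U₀).comp pA)
    ((F.dbar p q U₁).comp pB)
    (((F.cast (U₀ ⊓ U₁) rfl (show q = q + 1 - 1 by ring)).comp
        ((F.res p q inf_le_right).comp pB - (F.res p q inf_le_left).comp pA)) -
      ((F.cast (U₀ ⊓ U₁) rfl (show q - 1 + 1 = q + 1 - 1 by ring)).comp
        ((F.dbar p (q - 1) (U₀ ⊓ U₁)).comp pC)))

/-- the relative Čech differential `E^{p,q}_{BC}(𝒰,U₀) → E^{(p,q)+1}(𝒰,U₀)` -/
def RtoTT (p q : ℤ) : RBC F U₀ U₁ p q →ₗ[ℂ] RT F U₀ U₁ p q :=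
  LinearMap.prod
    (LinearMap.prod ((F.del p q U₁).comp qA) ((F.dbar p q U₁).comp qA))
    (((F.res p q inf_le_right).comp qA) -
      ((F.cast (U₀ ⊓ U₁) (show p - 1 + 1 = p by ring) (show q - 1 + 1 = q by ring)).comp
        ((F.dbar (p - 1 + 1) (q - 1) (U₀ ⊓ U₁)).comp
          ((F.del (p - 1) (q - 1) (U₀ ⊓ U₁)).comp qB))))

/-- the relative Čech differential `E^{(p,q)+1}(𝒰,U₀) → E^{p+1,q+1}_{A}(𝒰,U₀)` -/
def RtoTA (p q : ℤ) : RT F U₀ U₁ p q →ₗ[ℂ] RA F U₀ U₁ (p + 1) (q + 1) :=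
  LinearMap.prod
    (((F.dbar (p + 1) q U₁).comp (qA.comp qA)) + ((F.del p (q + 1) U₁).comp (qB.comp qA)))
    (LinearMap.prod
      ((F.cast (U₀ ⊓ U₁) rfl (show q = q + 1 - 1 by ring)).comp
        (((F.res (p + 1) q inf_le_right).comp (qA.comp qA)) -
          ((F.del p q (U₀ ⊓ U₁)).comp qB)))
      ((F.cast (U₀ ⊓ U₁) (show p = p + 1 - 1 by ring) rfl).comp
        (((F.res p (q + 1) inf_le_right).comp (qB.comp qA)) -
          ((F.dbar p q (U₀ ⊓ U₁)).comp qB))))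

/-- the relative Čech differential `E^{p,q}_{A}(𝒰,U₀) → E^{p+1,q+1}_{BC}(𝒰,U₀)` -/
def RtoTBC (p q : ℤ) : RA F U₀ U₁ p q →ₗ[ℂ] RBC F U₀ U₁ (p + 1) (q + 1) :=
  LinearMap.prod
    ((F.dbar (p + 1) q U₁).comp ((F.del p q U₁).comp qA))
    ((F.cast (U₀ ⊓ U₁) (show p = p + 1 - 1 by ring) (show q = q + 1 - 1 by ring)).comp
      ((((F.res p q inf_le_right).comp qA) -
          ((F.cast (U₀ ⊓ U₁) rfl (show q - 1 + 1 = q by ring)).comp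
            ((F.dbar p (q - 1) (U₀ ⊓ U₁)).comp (qA.comp qB)))) -
        ((F.cast (U₀ ⊓ U₁) (show p - 1 + 1 = p by ring) rfl).comp
          ((F.del (p - 1) q (U₀ ⊓ U₁)).comp (qB.comp qB)))))

/-- the relative Čech–Dolbeault differential -/
def DrD (p q : ℤ) : RD F U₀ U₁ p q →ₗ[ℂ] RD F U₀ U₁ p (q + 1) :=
  LinearMap.prod
    ((F.dbar p q U₁).comp qA)
    (((F.cast (U₀ ⊓ U₁) rfl (show q = q + 1 - 1 by ring)).comp
        ((F.res p q inf_le_right).comp qA)) -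
      ((F.cast (U₀ ⊓ U₁) rfl (show q - 1 + 1 = q + 1 - 1 by ring)).comp
        ((F.dbar p (q - 1) (U₀ ⊓ U₁)).comp qB)))

/-- identification of Čech–Bott–Chern cochains in equal bidegrees -/
def castTBC {p q p' q' : ℤ} (hp : p = p') (hq : q = q') :
    TBC F U₀ U₁ p q →ₗ[ℂ] TBC F U₀ U₁ p' q' :=
  lmTri ((F.cast U₀ hp hq).comp pA) ((F.cast U₁ hp hq).comp pB)
    ((F.cast _ (by rw [hp]) (by rw [hq])).comp pC)

/-- identification of Čech–Aeppli cochains in equal bidegrees -/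
def castTA {p q p' q' : ℤ} (hp : p = p') (hq : q = q') :
    TA F U₀ U₁ p q →ₗ[ℂ] TA F U₀ U₁ p' q' :=
  lmTri ((F.cast U₀ hp hq).comp pA) ((F.cast U₁ hp hq).comp pB)
    (LinearMap.prod ((F.cast _ hp (by rw [hq])).comp (qA.comp pC))
      ((F.cast _ (by rw [hp]) hq).comp (qB.comp pC)))

/-- identification of Čech–Dolbeault cochains in equal bidegrees -/
def castTD {p q p' q' : ℤ} (hp : p = p') (hq : q = q') :
    TD F U₀ U₁ p q →ₗ[ℂ] TD F U₀ U₁ p' q' :=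
  lmTri ((F.cast U₀ hp hq).comp pA) ((F.cast U₁ hp hq).comp pB)
    ((F.cast _ hp (by rw [hq])).comp pC)

/-- identification of relative Čech–Bott–Chern cochains in equal bidegrees -/
def castRBC {p q p' q' : ℤ} (hp : p = p') (hq : q = q') :
    RBC F U₀ U₁ p q →ₗ[ℂ] RBC F U₀ U₁ p' q' :=
  LinearMap.prod ((F.cast U₁ hp hq).comp qA)
    ((F.cast _ (by rw [hp]) (by rw [hq])).comp qB)

/-- identification of relative Čech–Aeppli cochains in equal bidegrees -/
def castRA {p q p' q' : ℤ} (hp : p = p') (hq : q = q') :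
    RA F U₀ U₁ p q →ₗ[ℂ] RA F U₀ U₁ p' q' :=
  LinearMap.prod ((F.cast U₁ hp hq).comp qA)
    (LinearMap.prod ((F.cast _ hp (by rw [hq])).comp (qA.comp qB))
      ((F.cast _ (by rw [hp]) hq).comp (qB.comp qB)))

/-- identification of relative Čech–Dolbeault cochains in equal bidegrees -/
def castRD {p q p' q' : ℤ} (hp : p = p') (hq : q = q') :
    RD F U₀ U₁ p q →ₗ[ℂ] RD F U₀ U₁ p' q' :=
  LinearMap.prod ((F.cast U₁ hp hq).comp qA)
    ((F.cast _ hp (by rw [hq])).comp qB)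

/-- the Čech–Bott–Chern cohomology `H^{p,q}_{BC}(𝒰)` -/
abbrev HBCcech (p q : ℤ) : Type u :=
  cohomOf
    ((castTBC F U₀ U₁ (show p - 1 + 1 = p by ring) (show q - 1 + 1 = q by ring)).comp
      (DtoTBC F U₀ U₁ (p - 1) (q - 1)))
    (DtoTT F U₀ U₁ p q)

/-- the Čech–Aeppli cohomology `H^{p,q}_{A}(𝒰)` -/
abbrev HAcech (p q : ℤ) : Type u :=
  cohomOf
    ((castTA F U₀ U₁ (show p - 1 + 1 = p by ring) (show q - 1 + 1 = q by ring)).comp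
      (DtoTA F U₀ U₁ (p - 1) (q - 1)))
    (DtoTBC F U₀ U₁ p q)

/-- the Čech cohomology of the third type `H^{(p,q)+1}(𝒰)` -/
abbrev HTcech (p q : ℤ) : Type u :=
  cohomOf (DtoTT F U₀ U₁ p q) (DtoTA F U₀ U₁ p q)

/-- the Čech–Dolbeault cohomology `H^{p,q}_{∂̄ϑ}(𝒰)` -/
abbrev HDcech (p q : ℤ) : Type u :=
  cohomOf ((castTD F U₀ U₁ rfl (show q - 1 + 1 = q by ring)).comp (DD F U₀ U₁ p (q - 1)))
    (DD F U₀ U₁ p q)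

/-- the relative Bott–Chern cohomology `H^{p,q}_{BC}(𝒰, U₀)` -/
abbrev HBCrel (p q : ℤ) : Type u :=
  cohomOf
    ((castRBC F U₀ U₁ (show p - 1 + 1 = p by ring) (show q - 1 + 1 = q by ring)).comp
      (RtoTBC F U₀ U₁ (p - 1) (q - 1)))
    (RtoTT F U₀ U₁ p q)

/-- the relative Aeppli cohomology `H^{p,q}_{A}(𝒰, U₀)` -/
abbrev HArel (p q : ℤ) : Type u :=
  cohomOf
    ((castRA F U₀ U₁ (show p - 1 + 1 = p by ring) (show q - 1 + 1 = q by ring)).comp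
      (RtoTA F U₀ U₁ (p - 1) (q - 1)))
    (RtoTBC F U₀ U₁ p q)

/-- the relative cohomology of the third type `H^{(p,q)+1}(𝒰, U₀)` -/
abbrev HTrel (p q : ℤ) : Type u :=
  cohomOf (RtoTT F U₀ U₁ p q) (RtoTA F U₀ U₁ p q)

/-- the relative Dolbeault cohomology `H^{p,q}_{∂̄ϑ}(𝒰, U₀)` -/
abbrev HDrel (p q : ℤ) : Type u :=
  cohomOf ((castRD F U₀ U₁ rfl (show q - 1 + 1 = q by ring)).comp (DrD F U₀ U₁ p (q - 1)))
    (DrD F U₀ U₁ p q)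

end Cech

section OpenSet

variable (W : Opens X)

/-- the differential `∂̄ + ∂ : E^{(p-1,q-1)+1}(W) → E^{p,q}(W)`, `(η₁, η₂) ↦ ∂̄η₁ + ∂η₂` -/
def plusW (p q : ℤ) :
    (↥(F.E p (q - 1) W) × ↥(F.E (p - 1) q W)) →ₗ[ℂ] ↥(F.E p q W) :=
  ((F.cast W rfl (show q - 1 + 1 = q by ring)).comp ((F.dbar p (q - 1) W).comp qA)) +
    ((F.cast W (show p - 1 + 1 = p by ring) rfl).comp ((F.del (p - 1) q W).comp qB))

/-- the differential `∂̄∂ : E^{p,q}(W) → E^{p+1,q+1}(W)` -/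
def ddbarW (p q : ℤ) : ↥(F.E p q W) →ₗ[ℂ] ↥(F.E (p + 1) (q + 1) W) :=
  (F.dbar (p + 1) q W).comp (F.del p q W)

/-- the differential `d : E^{p,q}(W) → E^{(p,q)+1}(W)`, `ω ↦ (∂ω, ∂̄ω)` -/
def dfullW (p q : ℤ) :
    ↥(F.E p q W) →ₗ[ℂ] (↥(F.E (p + 1) q W) × ↥(F.E p (q + 1) W)) :=
  LinearMap.prod (F.del p q W) (F.dbar p q W)

/-- the differential `∂̄ + ∂ : E^{(p,q)+1}(W) → E^{p+1,q+1}(W)`, `(α, β) ↦ ∂̄α + ∂β` -/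
def plusTW (p q : ℤ) :
    (↥(F.E (p + 1) q W) × ↥(F.E p (q + 1) W)) →ₗ[ℂ] ↥(F.E (p + 1) (q + 1) W) :=
  ((F.dbar (p + 1) q W).comp qA) + ((F.del p (q + 1) W).comp qB)

/-- the Bott–Chern cohomology `H^{p,q}_{BC}(W)` of an open set `W` -/
abbrev HBCopen (p q : ℤ) : Type u :=
  cohomOf
    ((F.cast W (show p - 1 + 1 = p by ring) (show q - 1 + 1 = q by ring)).comp
      (ddbarW F W (p - 1) (q - 1)))
    (dfullW F W p q)

/-- the Aeppli cohomology `H^{p,q}_{A}(W)` of an open set `W` -/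
abbrev HAopen (p q : ℤ) : Type u :=
  cohomOf (plusW F W p q) (ddbarW F W p q)

/-- the cohomology of the third type `H^{(p,q)+1}(W)` of an open set `W` -/
abbrev HTopen (p q : ℤ) : Type u :=
  cohomOf (dfullW F W p q) (plusTW F W p q)

/-- the Dolbeault cohomology `H^{p,q}_{∂̄}(W)` of an open set `W` -/
abbrev HDopen (p q : ℤ) : Type u :=
  cohomOf ((F.cast W rfl (show q - 1 + 1 = q by ring)).comp (F.dbar p (q - 1) W))
    (F.dbar p q W)

end OpenSet

section Tilde

variable (U₀ U₁ : Opens X)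

/-- the map `ω ↦ (ω|_{U₀}, ω|_{U₁}, 0)` into Čech–Bott–Chern cochains -/
def tBC (p q : ℤ) : ↥(F.E p q ⊤) →ₗ[ℂ] TBC F U₀ U₁ p q :=
  lmTri (F.res p q le_top) (F.res p q le_top) 0

/-- the map `ω ↦ (ω|_{U₀}, ω|_{U₁}, 0, 0)` into Čech–Aeppli cochains -/
def tA (p q : ℤ) : ↥(F.E p q ⊤) →ₗ[ℂ] TA F U₀ U₁ p q :=
  lmTri (F.res p q le_top) (F.res p q le_top) 0

/-- the map `ω ↦ (ω|_{U₀}, ω|_{U₁}, 0)` into Čech–Dolbeault cochains -/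
def tD (p q : ℤ) : ↥(F.E p q ⊤) →ₗ[ℂ] TD F U₀ U₁ p q :=
  lmTri (F.res p q le_top) (F.res p q le_top) 0

end Tilde

end DoubleFormSheaf


namespace DoubleFormSheaf

variable {X : Type u} [TopologicalSpace X] (F : DoubleFormSheaf X) (U₀ U₁ : Opens X)

/-- Čech–de Rham cochains of total degree `2n - 1` on an `n`-dimensional complex manifold:
`E^{2n-1}(U₀) ⊕ E^{2n-1}(U₁) ⊕ E^{2n-2}(U₀₁)`. -/
abbrev DR1 (n : ℤ) : Type u :=
  (↥(F.E n (n - 1) U₀) × ↥(F.E (n - 1) n U₀)) ×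
    (↥(F.E n (n - 1) U₁) × ↥(F.E (n - 1) n U₁)) ×
    (↥(F.E n (n - 2) (U₀ ⊓ U₁)) × ↥(F.E (n - 1) (n - 1) (U₀ ⊓ U₁)) ×
      ↥(F.E (n - 2) n (U₀ ⊓ U₁)))

set_option maxHeartbeats 2000000 in
/-- the Čech–de Rham differential `E^{2n-1}(𝒰) → E^{2n}(𝒰)`,
`(ζ₀, ζ₁, ζ₀₁) ↦ (dζ₀, dζ₁, ζ₁ - ζ₀ - dζ₀₁)` (in terms of the bigraded components) -/
def DRd1 (n : ℤ) : DR1 F U₀ U₁ n →ₗ[ℂ] TA F U₀ U₁ n n :=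
  lmTri
    (((F.cast U₀ rfl (show n - 1 + 1 = n by ring)).comp
        ((F.dbar n (n - 1) U₀).comp (qA.comp pA))) +
      ((F.cast U₀ (show n - 1 + 1 = n by ring) rfl).comp
        ((F.del (n - 1) n U₀).comp (qB.comp pA))))
    (((F.cast U₁ rfl (show n - 1 + 1 = n by ring)).comp
        ((F.dbar n (n - 1) U₁).comp (qA.comp pB))) +
      ((F.cast U₁ (show n - 1 + 1 = n by ring) rfl).comp
        ((F.del (n - 1) n U₁).comp (qB.comp pB))))
    (LinearMap.prod
      ((((F.res n (n - 1) inf_le_right).comp (qA.comp pB)) -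
          ((F.res n (n - 1) inf_le_left).comp (qA.comp pA))) -
        (((F.cast _ rfl (show n - 2 + 1 = n - 1 by ring)).comp
            ((F.dbar n (n - 2) (U₀ ⊓ U₁)).comp (pA.comp pC))) +
          ((F.cast _ (show n - 1 + 1 = n by ring) rfl).comp
            ((F.del (n - 1) (n - 1) (U₀ ⊓ U₁)).comp (pB.comp pC)))))
      ((((F.res (n - 1) n inf_le_right).comp (qB.comp pB)) -
          ((F.res (n - 1) n inf_le_left).comp (qB.comp pA))) -
        (((F.cast _ rfl (show n - 1 + 1 = n by ring)).comp
            ((F.dbar (n - 1) (n - 1) (U₀ ⊓ U₁)).comp (pB.comp pC))) +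
          ((F.cast _ (show n - 2 + 1 = n - 1 by ring) rfl).comp
            ((F.del (n - 2) n (U₀ ⊓ U₁)).comp (pC.comp pC))))))

/-- the Čech–de Rham differential `E^{2n}(𝒰) → E^{2n+1}(𝒰)`,
`(ζ₀, ζ₁, ζ₀₁) ↦ (dζ₀, dζ₁, ζ₁ - ζ₀ - dζ₀₁)` (in terms of the bigraded components) -/
def DRd2 (n : ℤ) : TA F U₀ U₁ n n →ₗ[ℂ] TT F U₀ U₁ n n :=
  lmTri
    (LinearMap.prod ((F.del n n U₀).comp pA) ((F.dbar n n U₀).comp pA))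
    (LinearMap.prod ((F.del n n U₁).comp pB) ((F.dbar n n U₁).comp pB))
    ((((F.res n n inf_le_right).comp pB) - ((F.res n n inf_le_left).comp pA)) -
      (((F.cast _ rfl (show n - 1 + 1 = n by ring)).comp
          ((F.dbar n (n - 1) (U₀ ⊓ U₁)).comp (qA.comp pC))) +
        ((F.cast _ (show n - 1 + 1 = n by ring) rfl).comp
          ((F.del (n - 1) n (U₀ ⊓ U₁)).comp (qB.comp pC)))))

/-- the top-degree Čech–de Rham cohomology `H^{2n}_D(𝒰)` -/
abbrev H2nD (n : ℤ) : Type u := cohomOf (DRd1 F U₀ U₁ n) (DRd2 F U₀ U₁ n)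

end DoubleFormSheaf


namespace DoubleFormSheaf

variable {X : Type u} [TopologicalSpace X] (F : DoubleFormSheaf X)

lemma cast_self (U : Opens X) {p q : ℤ} (hp : p = p) (hq : q = q) (x : F.E p q U) :
    F.cast U hp hq x = x := rfl

lemma cast_cast (U : Opens X) {p q p' q' p'' q'' : ℤ} (hp : p = p') (hq : q = q')
    (hp' : p' = p'') (hq' : q' = q'') (x : F.E p q U) :
    F.cast U hp' hq' (F.cast U hp hq x) = F.cast U (hp.trans hp') (hq.trans hq') x := by
  subst hp hq hp' hq'; rfl

lemma res_cast {U V : Opens X} (h : U ≤ V) {p q p' q' : ℤ} (hp : p = p') (hq : q = q')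
    (x : F.E p q V) :
    F.res p' q' h (F.cast V hp hq x) = F.cast U hp hq (F.res p q h x) := by
  subst hp hq; rfl

lemma del_cast (U : Opens X) {p q p' q' : ℤ} (hp : p = p') (hq : q = q') (x : F.E p q U) :
    F.del p' q' U (F.cast U hp hq x) =
      F.cast U (congrArg (· + 1) hp) hq (F.del p q U x) := by
  subst hp hq; rfl

lemma dbar_cast (U : Opens X) {p q p' q' : ℤ} (hp : p = p') (hq : q = q') (x : F.E p q U) :
    F.dbar p' q' U (F.cast U hp hq x) =
      F.cast U hp (congrArg (· + 1) hq) (F.dbar p q U x) := by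
  subst hp hq; rfl

variable (U₀ U₁ : Opens X)

/-- In top bidegree the Čech–Aeppli and the Čech–de Rham cocycle conditions both reduce to
the condition on the overlap. -/
lemma ker_DtoTBC_eq_ker_DRd2 (n : ℤ)
    (hdim : ∀ (a b : ℤ) (U : Opens X), n < a ∨ n < b → Subsingleton (F.E a b U)) :
    LinearMap.ker (DtoTBC F U₀ U₁ n n) = LinearMap.ker (DRd2 F U₀ U₁ n) := by
  have := fun b U => hdim (n + 1) b U (Or.inl (by omega))
  have := fun a U => hdim a (n + 1) U (Or.inr (by omega))
  ext ⟨x₀, x₁, y, z⟩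
  have cast_eq_zero {p q p' q' : ℤ} (hp : p = p') (hq : q = q') (x : F.E p q (U₀ ⊓ U₁)) :
      F.cast _ hp hq x = 0 ↔ x = 0 := by
    subst hp hq; rfl
  simp only [LinearMap.mem_ker, DtoTBC, DRd2, lmTri, pA, pB, pC, qA, qB, LinearMap.prod_apply,
    Function.prod_apply, LinearMap.comp_apply, LinearMap.sub_apply, LinearMap.add_apply,
    LinearMap.fst_apply, LinearMap.snd_apply, Prod.mk_eq_zero, cast_eq_zero,
    eq_iff_true_of_subsingleton, true_and, sub_sub, add_assoc]

/-- In top bidegree the Čech–Aeppli and the Čech–de Rham coboundaries coincide: the additional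
primitives of types `(n, n-2)` and `(n-2, n)` on the overlap split by a partition of unity. -/
lemma range_DtoTA_eq_range_DRd1 (hcov : U₀ ⊔ U₁ = ⊤) (n : ℤ) :
    LinearMap.range
      ((castTA F U₀ U₁ (show n - 1 + 1 = n by ring) (show n - 1 + 1 = n by ring)).comp
        (DtoTA F U₀ U₁ (n - 1) (n - 1))) = LinearMap.range (DRd1 F U₀ U₁ n) := by
  have e₁ : n - 1 + 1 = n := by ring
  have e₂ : n - 2 + 1 = n - 1 := by ring
  obtain ⟨z₀, z₁, hz⟩ := F.pou hcov
  apply le_antisymm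
  · rintro _ ⟨⟨⟨a₀, b₀⟩, ⟨a₁, b₁⟩, c⟩, rfl⟩
    refine ⟨((F.cast U₀ e₁ rfl a₀, F.cast U₀ rfl e₁ b₀),
      (F.cast U₁ e₁ rfl a₁, F.cast U₁ rfl e₁ b₁), (0, c, 0)), ?_⟩
    simp only [castTA, DtoTA, DRd1, lmTri, pA, pB, pC, qA, qB, LinearMap.prod_apply,
      Function.prod_apply, LinearMap.comp_apply, LinearMap.sub_apply, LinearMap.add_apply,
      LinearMap.fst_apply, LinearMap.snd_apply, map_add, map_sub, map_zero, zero_add, add_zero,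
      cast_cast, res_cast, del_cast, dbar_cast]
  · rintro _ ⟨⟨⟨a₀, b₀⟩, ⟨a₁, b₁⟩, u, c, v⟩, rfl⟩
    refine ⟨((F.cast U₀ e₁.symm rfl (a₀ + F.cast U₀ rfl e₂ (F.dbar _ _ U₀ (z₀ _ _ u))),
        F.cast U₀ rfl e₁.symm (b₀ + F.cast U₀ e₂ rfl (F.del _ _ U₀ (z₀ _ _ v)))),
      (F.cast U₁ e₁.symm rfl (a₁ - F.cast U₁ rfl e₂ (F.dbar _ _ U₁ (z₁ _ _ u))),
        F.cast U₁ rfl e₁.symm (b₁ - F.cast U₁ e₂ rfl (F.del _ _ U₁ (z₁ _ _ v)))), c), ?_⟩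
    have hu := congrArg (F.dbar _ _ _) (hz _ _ u)
    have hv := congrArg (F.del _ _ _) (hz _ _ v)
    rw [map_add, res_dbar, res_dbar] at hu
    rw [map_add, res_del, res_del] at hv
    simp only [castTA, DtoTA, DRd1, lmTri, pA, pB, pC, qA, qB, LinearMap.prod_apply,
      Function.prod_apply, LinearMap.comp_apply, LinearMap.sub_apply, LinearMap.add_apply,
      LinearMap.fst_apply, LinearMap.snd_apply, map_add, map_sub, map_zero, add_zero, sub_zero,
      cast_cast, cast_self, res_cast, del_cast, dbar_cast, del_del, dbar_dbar, ← hu, ← hv,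
      Prod.mk.injEq, true_and]
    constructor <;> abel

end DoubleFormSheaf


open DoubleFormSheaf

set_option maxHeartbeats 2000000 in
/-- Proposition 4.4 of the paper: on an `n`-dimensional complex
manifold, `(ξ₀, ξ₁, ξ₀₁⁽¹⁾, ξ₀₁⁽²⁾) ↦ (ξ₀, ξ₁, ξ₀₁⁽¹⁾ + ξ₀₁⁽²⁾)` induces an isomorphism
`H^{n,n}_A(𝒰) ≅ H^{2n}_D(𝒰)`. -/
theorem statement12 {X : Type u} [TopologicalSpace X] (F : DoubleFormSheaf X)
    (U₀ U₁ : Opens X) (hcov : U₀ ⊔ U₁ = ⊤) (n : ℤ)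
    -- `M` has complex dimension `n`: there are no nonzero `(a,b)`-forms with `a > n` or `b > n`
    (hdim : ∀ (a b : ℤ) (U : Opens X), n < a ∨ n < b → Subsingleton (F.E a b U)) :
    ∃ e : HAcech F U₀ U₁ n n ≃ₗ[ℂ] H2nD F U₀ U₁ n,
      ∀ (ξ : TA F U₀ U₁ n n) (hξ : DtoTBC F U₀ U₁ n n ξ = 0),
        ∃ h', e (cohomMk _ (DtoTBC F U₀ U₁ n n) ξ hξ)
          = cohomMk (DRd1 F U₀ U₁ n) (DRd2 F U₀ U₁ n) ξ h' := by
  have hker := ker_DtoTBC_eq_ker_DRd2 F U₀ U₁ n hdim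
  refine ⟨Submodule.Quotient.equiv _ _ (LinearEquiv.ofEq _ _ hker) ?_, fun ξ hξ => ⟨?_, rfl⟩⟩
  · rw [range_DtoTA_eq_range_DRd1 F U₀ U₁ hcov n]
    ext x
    rw [Submodule.mem_map_equiv]
    rfl
  · exact LinearMap.mem_ker.mp (hker ▸ LinearMap.mem_ker.mpr hξ)
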